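/- Let A be a set with |A| ≥ 3 and let α₁, …, α_k ∈ Quo(A) be antisymmetric quasiorders (i.e., partial orders on A). If {α₁, …, α_k} generates Quo(A) in the complete sense (as a complete lattice, without involution), then {α₁ \ Δ_A, …, α_k \ Δ_A} (where Δ_A is the equality relation on A) generates Tran(A) in the complete sense. -/

import Mathlib

universe u

open Set

/-- The diagonal (equality) relation on `α`, as a set of pairs. -/
def diagRel (α : Type u) : Set (α × α) := {p | p.1 = p.2}

/-- A quasiorder (preorder): a reflexive and transitive binary relation, as a set of pairs. -/
def IsQuoRel {α : Type u} (r : Set (α × α)) : Prop :=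
  (∀ a : α, (a, a) ∈ r) ∧ ∀ a b c : α, (a, b) ∈ r → (b, c) ∈ r → (a, c) ∈ r

/-- A transitive binary relation, as a set of pairs. -/
def IsTranRel {α : Type u} (r : Set (α × α)) : Prop :=
  ∀ a b c : α, (a, b) ∈ r → (b, c) ∈ r → (a, c) ∈ r

/-- An equivalence relation, as a set of pairs. -/
def IsEquRel {α : Type u} (r : Set (α × α)) : Prop :=
  IsQuoRel r ∧ ∀ p : α × α, p ∈ r → (p.2, p.1) ∈ r

/-- `Quo(α)`: the set of all quasiorders on `α`. -/
def QuoRels (α : Type u) : Set (Set (α × α)) := {r | IsQuoRel r}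

/-- `Tran(α)`: the set of all transitive relations on `α`. -/
def TranRels (α : Type u) : Set (Set (α × α)) := {r | IsTranRel r}

/-- `Equ(α)`: the set of all equivalence relations on `α`. -/
def EquRels (α : Type u) : Set (Set (α × α)) := {r | IsEquRel r}

/-- The least quasiorder containing `r` (the reflexive-transitive closure of `r`). -/
def quoGen {α : Type u} (r : Set (α × α)) : Set (α × α) := ⋂₀ {s | IsQuoRel s ∧ r ⊆ s}

/-- The least transitive relation containing `r` (the transitive closure of `r`). -/
def tranGen {α : Type u} (r : Set (α × α)) : Set (α × α) := ⋂₀ {s | IsTranRel s ∧ r ⊆ s}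

/-- The least equivalence relation containing `r`. -/
def equGen {α : Type u} (r : Set (α × α)) : Set (α × α) := ⋂₀ {s | IsEquRel s ∧ r ⊆ s}

/-- `quo(a,b)`: the least quasiorder containing the pair `(a,b)`. -/
def quoPair {α : Type u} (a b : α) : Set (α × α) := quoGen {(a, b)}

/-- `equ(a,b)`: the least equivalence relation containing the pair `(a,b)`. -/
def equPair {α : Type u} (a b : α) : Set (α × α) := equGen {(a, b)}

/-- The involution: the inverse of a relation. -/
def invRel {α : Type u} (r : Set (α × α)) : Set (α × α) := {p | (p.2, p.1) ∈ r}

/-- `T` is closed under arbitrary (possibly infinite, possibly empty) joins and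
meets of the complete lattice `Quo(α)`: the meet of a family of quasiorders is its
intersection and the join is the quasiorder generated by its union. -/
def QuoClosed {α : Type u} (T : Set (Set (α × α))) : Prop :=
  (∀ S ⊆ T, quoGen (⋃₀ S) ∈ T) ∧ (∀ S ⊆ T, ⋂₀ S ∈ T)

/-- `X` generates the complete lattice `Quo(α)` in the complete sense. -/
def QuoGenerates {α : Type u} (X : Set (Set (α × α))) : Prop :=
  X ⊆ QuoRels α ∧ ∀ T ⊆ QuoRels α, X ⊆ T → QuoClosed T → T = QuoRels α

/-- `T` is closed under arbitrary joins and meets of the complete lattice `Tran(α)`. -/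
def TranClosed {α : Type u} (T : Set (Set (α × α))) : Prop :=
  (∀ S ⊆ T, tranGen (⋃₀ S) ∈ T) ∧ (∀ S ⊆ T, ⋂₀ S ∈ T)

/-- `X` generates the complete lattice `Tran(α)` in the complete sense. -/
def TranGenerates {α : Type u} (X : Set (Set (α × α))) : Prop :=
  X ⊆ TranRels α ∧ ∀ T ⊆ TranRels α, X ⊆ T → TranClosed T → T = TranRels α

/-- `X` generates `Quo(α)` as a complete involution lattice. -/
def QuoInvGenerates {α : Type u} (X : Set (Set (α × α))) : Prop :=
  X ⊆ QuoRels α ∧ ∀ T ⊆ QuoRels α, X ⊆ T → QuoClosed T →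
    (∀ r ∈ T, invRel r ∈ T) → T = QuoRels α

/-- `X` generates `Tran(α)` as a complete involution lattice. -/
def TranInvGenerates {α : Type u} (X : Set (Set (α × α))) : Prop :=
  X ⊆ TranRels α ∧ ∀ T ⊆ TranRels α, X ⊆ T → TranClosed T →
    (∀ r ∈ T, invRel r ∈ T) → T = TranRels α

/-- Incomparability (with respect to inclusion). -/
def Incomp {α : Type u} (a b : Set (α × α)) : Prop := ¬ a ⊆ b ∧ ¬ b ⊆ a

/-- The complete lattice `Quo(α)` is `(1+1+2)`-generated: it is generated, in the
complete sense, by a four-element set `{x₁,x₂,x₃,x₄}` with `x₁ < x₂` such that both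
`{x₁,x₃,x₄}` and `{x₂,x₃,x₄}` are antichains. -/
def QuoOneOneTwoGenerated (α : Type u) : Prop :=
  ∃ x₁ x₂ x₃ x₄ : Set (α × α),
    x₁ ⊂ x₂ ∧ Incomp x₁ x₃ ∧ Incomp x₁ x₄ ∧ Incomp x₂ x₃ ∧ Incomp x₂ x₄ ∧
    Incomp x₃ x₄ ∧ QuoGenerates {x₁, x₂, x₃, x₄}

/-- A cardinal is accessible: it is finite, or it is infinite and every cardinal
`lam ≤ κ` satisfies `lam ≤ 2 ^ μ` for some `μ < lam`, or is at most a sum of fewer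
than `lam` many cardinals each smaller than `lam`. -/
def AccessibleCard (κ : Cardinal.{u}) : Prop :=
  κ < Cardinal.aleph0 ∨
    (Cardinal.aleph0 ≤ κ ∧ ∀ lam : Cardinal.{u}, lam ≤ κ →
      (∃ μ : Cardinal.{u}, μ < lam ∧ lam ≤ 2 ^ μ) ∨
      ∃ (ι : Type u) (f : ι → Cardinal.{u}),
        Cardinal.mk ι < lam ∧ (∀ i : ι, f i < lam) ∧ lam ≤ Cardinal.sum f)
theorem subset_tranGen {α : Type u} (r : Set (α × α)) : r ⊆ tranGen r :=
  fun _ hp _ hs => hs.2 hp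

theorem tranGen_subset {α : Type u} {r s : Set (α × α)} (hs : IsTranRel s) (h : r ⊆ s) :
    tranGen r ⊆ s :=
  fun _ hp => hp s ⟨hs, h⟩

theorem isTranRel_tranGen {α : Type u} (r : Set (α × α)) : IsTranRel (tranGen r) :=
  fun a b c hab hbc s hs => hs.1 a b c (hab s hs) (hbc s hs)

theorem subset_quoGen {α : Type u} (r : Set (α × α)) : r ⊆ quoGen r :=
  fun _ hp _ hs => hs.2 hp

theorem quoGen_subset {α : Type u} {r s : Set (α × α)} (hs : IsQuoRel s) (h : r ⊆ s) :
    quoGen r ⊆ s :=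
  fun _ hp => hp s ⟨hs, h⟩

theorem isQuoRel_quoGen {α : Type u} (r : Set (α × α)) : IsQuoRel (quoGen r) :=
  ⟨fun a _ hs => hs.1.1 a, fun a b c hab hbc s hs => hs.1.2 a b c (hab s hs) (hbc s hs)⟩

theorem isQuoRel_sInter {α : Type u} {S : Set (Set (α × α))} (hS : ∀ s ∈ S, IsQuoRel s) :
    IsQuoRel (⋂₀ S) :=
  ⟨fun a s hs => (hS s hs).1 a,
    fun a b c hab hbc s hs => (hS s hs).2 a b c (hab s hs) (hbc s hs)⟩

theorem IsTranRel.union_diagRel {α : Type u} {t : Set (α × α)} (ht : IsTranRel t) :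
    IsQuoRel (t ∪ diagRel α) := by
  refine ⟨fun a => Or.inr rfl, ?_⟩
  rintro a b c (hab | hab) (hbc | hbc)
  · exact Or.inl (ht a b c hab hbc)
  · obtain rfl : b = c := hbc
    exact Or.inl hab
  · obtain rfl : a = b := hab
    exact Or.inl hbc
  · obtain rfl : a = b := hab
    exact Or.inr hbc

theorem isTranRel_diff_diagRel {α : Type u} {r : Set (α × α)} (hr : IsQuoRel r)
    (hanti : ∀ p : α × α, p ∈ r → (p.2, p.1) ∈ r → p.1 = p.2) :
    IsTranRel (r \ diagRel α) := by
  rintro a b c ⟨hab, hne⟩ ⟨hbc, -⟩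
  refine ⟨hr.2 a b c hab hbc, fun hac => hne ?_⟩
  obtain rfl : a = c := hac
  exact hanti (a, b) hab hbc

theorem isTranRel_singleton {α : Type u} {a b : α} (hab : a ≠ b) :
    IsTranRel ({(a, b)} : Set (α × α)) := by
  intro x y z hxy hyz
  simp only [mem_singleton_iff, Prod.mk.injEq] at hxy hyz
  exact absurd (hyz.1.symm.trans hxy.2) hab

theorem quoGen_sUnion_union_diagRel {α : Type u} {S S₀ : Set (Set (α × α))}
    (hS : S = (fun t => t ∪ diagRel α) '' S₀) :
    quoGen (⋃₀ S) = tranGen (⋃₀ S₀) ∪ diagRel α := by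
  subst hS
  apply Subset.antisymm
  · refine quoGen_subset (isTranRel_tranGen _).union_diagRel ?_
    rintro p ⟨_, ⟨t, ht, rfl⟩, hp⟩
    exact hp.imp_left fun hp => subset_tranGen _ ⟨t, ht, hp⟩
  · apply union_subset
    · refine tranGen_subset (isQuoRel_quoGen _).2 ?_
      rintro p ⟨t, ht, hp⟩
      exact subset_quoGen _ ⟨_, ⟨t, ht, rfl⟩, Or.inl hp⟩
    · rintro ⟨x, y⟩ h
      obtain rfl : x = y := h
      exact (isQuoRel_quoGen _).1 x

/-- Adding the diagonal maps complete sublattices of `Tran(α)` to complete sublattices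
of `Quo(α)`. -/
theorem TranClosed.quoClosed_image {α : Type u} {T : Set (Set (α × α))} (hT : TranClosed T) :
    QuoClosed ((fun t => t ∪ diagRel α) '' T) := by
  constructor <;> intro S hS <;> obtain ⟨S₀, hS₀, rfl⟩ := subset_image_iff.1 hS
  · exact ⟨_, hT.1 S₀ hS₀, (quoGen_sUnion_union_diagRel rfl).symm⟩
  · refine ⟨_, hT.2 S₀ hS₀, ?_⟩
    ext p
    simp only [mem_union, mem_sInter, mem_image, forall_exists_index, and_imp,
      forall_apply_eq_imp_iff₂]
    by_cases hp : p ∈ diagRel α <;> simp [hp]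

/-- A generating set of `Quo(α)` is not contained in a proper principal ideal. -/
theorem QuoGenerates.eq_univ {α : Type u} {X : Set (Set (α × α))} (hX : QuoGenerates X)
    {R : Set (α × α)} (hR : IsQuoRel R) (h : ∀ r ∈ X, r ⊆ R) : R = univ := by
  have key := hX.2 {s | IsQuoRel s ∧ (s = univ ∨ s ⊆ R)} (fun s hs => hs.1)
    (fun r hr => ⟨hX.1 hr, Or.inr (h r hr)⟩) ⟨fun S hS => ⟨isQuoRel_quoGen _, ?_⟩,
      fun S hS => ⟨isQuoRel_sInter fun s hs => (hS hs).1, ?_⟩⟩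
  · refine eq_univ_of_forall fun ⟨a, b⟩ => ?_
    by_cases hab : a = b
    · exact hab ▸ hR.1 a
    have hq : ({(a, b)} ∪ diagRel α) ∈ QuoRels α := (isTranRel_singleton hab).union_diagRel
    rw [← key] at hq
    rcases hq.2 with hu | hs
    · have hba : (b, a) ∈ ({(a, b)} ∪ diagRel α : Set (α × α)) := hu ▸ mem_univ _
      rcases hba with hba | hba
      · exact absurd (congrArg Prod.snd hba) hab
      · exact absurd (Eq.symm hba) hab
    · exact hs (Or.inl rfl)
  · by_cases hu : univ ∈ S
    · exact Or.inl (univ_subset_iff.1 ((subset_sUnion_of_mem hu).trans (subset_quoGen _)))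
    · refine Or.inr (quoGen_subset hR (sUnion_subset fun s hs => ?_))
      exact (hS hs).2.resolve_left fun he => hu (he ▸ hs)
  · by_cases hu : ∃ s ∈ S, s ≠ univ
    · obtain ⟨s, hs, hne⟩ := hu
      exact Or.inr ((sInter_subset_of_mem hs).trans ((hS hs).2.resolve_left hne))
    · push Not at hu
      exact Or.inl (sInter_eq_univ.2 hu)

theorem TranClosed.inter_mem {α : Type u} {T : Set (Set (α × α))} (hT : TranClosed T)
    {s t : Set (α × α)} (hs : s ∈ T) (ht : t ∈ T) : s ∩ t ∈ T := by
  rw [← sInter_pair]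
  exact hT.2 _ (pair_subset hs ht)

theorem TranClosed.tranGen_union_mem {α : Type u} {T : Set (Set (α × α))} (hT : TranClosed T)
    {s t : Set (α × α)} (hs : s ∈ T) (ht : t ∈ T) : tranGen (s ∪ t) ∈ T := by
  rw [← sUnion_pair]
  exact hT.1 _ (pair_subset hs ht)

/-- A complete sublattice containing all singletons is everything. -/
theorem TranClosed.eq_tranRels {α : Type u} {T : Set (Set (α × α))} (hT : TranClosed T)
    (hsub : T ⊆ TranRels α) (h : ∀ p : α × α, {p} ∈ T) : T = TranRels α := by
  refine hsub.antisymm fun r hr => ?_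
  have hS := hT.1 ((fun p => {p}) '' r) (image_subset_iff.2 fun p _ => h p)
  rw [sUnion_image, biUnion_of_singleton] at hS
  rwa [(tranGen_subset hr Subset.rfl).antisymm (subset_tranGen r)] at hS

/-- Off-diagonal singletons generate the diagonal ones once a third point is available. -/
theorem TranClosed.singleton_diag_mem {α : Type u} {T : Set (Set (α × α))} (hT : TranClosed T)
    (h : ∀ x y : α, x ≠ y → {(x, y)} ∈ T) {a b c : α} (hab : a ≠ b) (hac : a ≠ c)
    (hbc : b ≠ c) : {(a, a)} ∈ T := by
  have hloop : ∀ x : α, (a, a) ∈ tranGen ({(a, x)} ∪ {(x, a)}) := fun x =>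
    isTranRel_tranGen _ a x a (subset_tranGen _ (Or.inl rfl)) (subset_tranGen _ (Or.inr rfl))
  have hbox : ∀ x : α, tranGen ({(a, x)} ∪ {(x, a)}) ⊆ ({a, x} : Set α) ×ˢ {a, x} := fun x =>
    tranGen_subset (fun _ _ _ h₁ h₂ => ⟨h₁.1, h₂.2⟩) (by rintro _ (rfl | rfl) <;> simp)
  have hmem := hT.inter_mem (hT.tranGen_union_mem (h a b hab) (h b a hab.symm))
    (hT.tranGen_union_mem (h a c hac) (h c a hac.symm))
  convert hmem
  apply Subset.antisymm
  · exact singleton_subset_iff.2 ⟨hloop b, hloop c⟩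
  · rintro ⟨x, y⟩ ⟨h₁, h₂⟩
    have h₁ := hbox b h₁
    have h₂ := hbox c h₂
    simp only [mem_prod, mem_insert_iff, mem_singleton_iff, Prod.mk.injEq] at h₁ h₂ ⊢
    grind

/-- If `|A| ≥ 3` and `α₁, …, α_k` are antisymmetric quasiorders (partial orders) on `A`
generating the complete lattice `Quo(A)` (no involution), then the relations `αᵢ \ Δ_A`
generate the complete lattice `Tran(A)`. -/
theorem tran_generated_of_quo_generated {α : Type u} (h3 : 3 ≤ Cardinal.mk α)
    (k : ℕ) (a : Fin k → Set (α × α))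
    (hquo : ∀ i : Fin k, IsQuoRel (a i))
    (hanti : ∀ i : Fin k, ∀ p : α × α, p ∈ a i → (p.2, p.1) ∈ a i → p.1 = p.2)
    (hgen : QuoGenerates (Set.range a)) :
    TranGenerates (Set.range fun i : Fin k => a i \ diagRel α) := by
  refine ⟨?_, fun T hsub hX hT => ?_⟩
  · rintro _ ⟨i, rfl⟩
    exact isTranRel_diff_diagRel (hquo i) (hanti i)
  have himage : (fun t => t ∪ diagRel α) '' T = QuoRels α := by
    refine hgen.2 _ ?_ ?_ hT.quoClosed_image
    · rintro _ ⟨t, ht, rfl⟩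
      exact (hsub ht).union_diagRel
    · rintro _ ⟨i, rfl⟩
      refine ⟨_, hX ⟨i, rfl⟩, ?_⟩
      refine sdiff_union_self.trans (union_eq_left.2 ?_)
      rintro ⟨x, y⟩ hxy
      obtain rfl : x = y := hxy
      exact (hquo i).1 x
  have hsingle : ∀ {x y : α} {s : Set (α × α)}, s ∈ T → (x, y) ∈ s → Disjoint s (diagRel α) →
      {(x, y)} ∈ T := by
    intro x y s hs hxy hdisj
    have hne : x ≠ y := fun h => disjoint_left.1 hdisj hxy h
    obtain ⟨t, ht, htxy⟩ := himage.ge (isTranRel_singleton hne).union_diagRel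
    convert hT.inter_mem hs ht
    refine Subset.antisymm (singleton_subset_iff.2 ⟨hxy, ?_⟩) ?_
    · exact (htxy.ge (Or.inl rfl)).resolve_right hne
    · rintro p ⟨hps, hpt⟩
      exact (htxy.le (Or.inl hpt)).resolve_right (disjoint_left.1 hdisj hps)
  have hR : {p : α × α | p.1 = p.2 ∨ {p} ∈ T} = univ := by
    refine hgen.eq_univ ⟨fun x => Or.inl rfl, ?_⟩ ?_
    · rintro x y z (hxy | hxy) (hyz | hyz)
      · exact Or.inl (hxy.trans hyz)
      · obtain rfl : x = y := hxy
        exact Or.inr hyz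
      · obtain rfl : y = z := hyz
        exact Or.inr hxy
      by_cases hne : x = y ∨ y = z ∨ x = z
      · rcases hne with rfl | rfl | rfl
        · exact Or.inr hyz
        · exact Or.inr hxy
        · exact Or.inl rfl
      push Not at hne
      obtain ⟨h₁, h₂, h₃⟩ := hne
      have hchain : tranGen ({(x, y)} ∪ {(y, z)}) ⊆ {(x, y), (y, z), (x, z)} := by
        refine tranGen_subset ?_ (by rintro _ (rfl | rfl) <;> simp)
        intro u v w huv hvw
        simp only [mem_insert_iff, mem_singleton_iff, Prod.mk.injEq] at huv hvw ⊢
        grind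
      refine Or.inr (hsingle (hT.tranGen_union_mem hxy hyz) (isTranRel_tranGen _ x y z
        (subset_tranGen _ (Or.inl rfl)) (subset_tranGen _ (Or.inr rfl))) ?_)
      refine Disjoint.mono_left hchain (disjoint_left.2 ?_)
      rintro _ (rfl | rfl | rfl)
      exacts [h₁, h₂, h₃]
    · rintro _ ⟨i, rfl⟩ p hp
      by_cases hd : p.1 = p.2
      · exact Or.inl hd
      · exact Or.inr (hsingle (hX ⟨i, rfl⟩) ⟨hp, hd⟩ disjoint_sdiff_left)
  have hoff : ∀ x y : α, x ≠ y → {(x, y)} ∈ T := fun x y hxy =>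
    (hR.ge (mem_univ (x, y))).resolve_left hxy
  refine hT.eq_tranRels hsub fun ⟨x, y⟩ => ?_
  by_cases hxy : x = y
  · subst hxy
    obtain ⟨b, hb, -⟩ := Cardinal.exists_ne_ne_of_three_le h3 x x
    obtain ⟨c, hcx, hcb⟩ := Cardinal.exists_ne_ne_of_three_le h3 x b
    exact hT.singleton_diag_mem hoff hb.symm hcx.symm hcb.symm
  · exact hoff x y hxy
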